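/- For every α with 0 < α ≤ 1 there exists a finite positive Borel measure μ on the open unit disk 𝔻 satisfying μ(S(I)) = O((log(1/|I|))^{-1} (log log(1/|I|))^{-α}) as |I| → 0, such that μ is not a Carleson measure for the Dirichlet space 𝒟. -/

import Mathlib

open MeasureTheory Metric Complex Filter Set

noncomputable section

/-- Membership in the Dirichlet space: `f` is holomorphic on the unit disk and
its Dirichlet integral is finite. -/
def InDirichlet (f : ℂ → ℂ) : Prop :=
  DifferentiableOn ℂ f (Metric.ball (0:ℂ) 1) ∧
    IntegrableOn (fun z => ‖deriv f z‖ ^ 2) (Metric.ball (0:ℂ) 1) volume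

/-- The square of the Dirichlet norm: `‖f‖_𝒟² = |f(0)|² + (1/π)∫_𝔻 |f′|² dA`. -/
def dirichletNormSq (f : ℂ → ℂ) : ℝ :=
  ‖f 0‖ ^ 2 + (1 / Real.pi) * ∫ z in Metric.ball (0:ℂ) 1, ‖deriv f z‖ ^ 2

/-- `μ` is a Carleson measure for the Dirichlet space. -/
def IsCarlesonDirichlet (μ : Measure ℂ) : Prop :=
  ∃ C : ℝ, ∀ f : ℂ → ℂ, InDirichlet f →
    ∫⁻ z in Metric.ball (0:ℂ) 1, ENNReal.ofReal (‖f z‖ ^ 2) ∂μ ≤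
      ENNReal.ofReal (C * dirichletNormSq f)

/-- The Carleson box `S(I)` over the arc `I = {e^{iα} : θ ≤ α ≤ θ + ℓ}` of arclength `ℓ`. -/
def carlesonBox (θ ℓ : ℝ) : Set ℂ :=
  {z : ℂ | ∃ r α : ℝ, 1 - ℓ < r ∧ r < 1 ∧ θ ≤ α ∧ α ≤ θ + ℓ ∧
    z = r * Complex.exp (α * Complex.I)}

/-! ### A Cantor-type family of finite point sets -/

/-- The logarithm of the reciprocal of the `i`-th gap length. -/
def gapLog (i : ℕ) : ℝ := 24 * 2 ^ i / (i + 2)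

/-- The `i`-th gap length of the Cantor-type construction. -/
def gap (i : ℕ) : ℝ := Real.exp (-gapLog i)

lemma gapLog_succ_sub (i : ℕ) :
    gapLog (i + 1) - gapLog i = 24 * 2 ^ i * (i + 1) / ((i + 2) * (i + 3)) := by
  unfold gapLog
  push_cast
  field_simp
  ring

lemma inv_succ_le_gapLog_succ_sub (i : ℕ) :
    1 / ((i : ℝ) + 1) ≤ (gapLog (i + 1) - gapLog i) / 2 ^ (i + 1) := by
  have h : (gapLog (i + 1) - gapLog i) / 2 ^ (i + 1)
      = 12 * (i + 1) / (((i : ℝ) + 2) * (i + 3)) := by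
    rw [gapLog_succ_sub, pow_succ]
    field_simp
    ring
  rw [h, div_le_div_iff₀ (by positivity) (by positivity)]
  have : (0 : ℝ) ≤ i := by positivity
  nlinarith

lemma four_le_gapLog_succ_sub (i : ℕ) : 4 ≤ gapLog (i + 1) - gapLog i := by
  have h2 : (i : ℝ) + 1 ≤ 2 ^ i := by exact_mod_cast Nat.lt_two_pow_self (n := i)
  rw [gapLog_succ_sub, le_div_iff₀ (by positivity)]
  have : (0 : ℝ) ≤ i := by positivity
  have h3 : (24 : ℝ) * (i + 1) * (i + 1) ≤ 24 * 2 ^ i * (i + 1) := by gcongr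
  nlinarith

lemma gapLog_zero : gapLog 0 = 12 := by norm_num [gapLog]

lemma gapLog_mono : Monotone gapLog :=
  monotone_nat_of_le_succ fun i => by linarith [four_le_gapLog_succ_sub i]

lemma gap_pos (i : ℕ) : 0 < gap i := Real.exp_pos _

lemma gap_anti : Antitone gap := fun _ _ h => Real.exp_le_exp.2 (neg_le_neg (gapLog_mono h))

lemma gap_succ_le (i : ℕ) : gap (i + 1) ≤ gap i / 32 := by
  have h4 : (32 : ℝ) ≤ Real.exp 4 := by
    have h := Real.exp_one_gt_d9
    have : Real.exp 4 = Real.exp 1 ^ 4 := by rw [← Real.exp_nat_mul]; norm_num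
    rw [this]
    calc (32 : ℝ) ≤ 2.7 ^ 4 := by norm_num
      _ ≤ _ := by gcongr; linarith
  have h : gap (i + 1) * Real.exp 4 ≤ gap i := by
    unfold gap
    rw [← Real.exp_add]
    exact Real.exp_le_exp.2 (by linarith [four_le_gapLog_succ_sub i])
  rw [le_div_iff₀ (by norm_num)]
  exact (mul_le_mul_of_nonneg_left h4 (gap_pos _).le).trans h

lemma gap_lt_half (i : ℕ) : gap i < 1 / 2 := by
  have h : gap i ≤ gap 0 := gap_anti (Nat.zero_le i)
  have h0 : gap 0 < 1 / 2 := by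
    rw [gap, gapLog_zero, Real.exp_neg, one_div]
    exact inv_strictAnti₀ (by norm_num) (by linarith [Real.add_one_le_exp (12 : ℝ)])
  linarith

lemma sum_gap_le (m k : ℕ) : ∑ i ∈ Finset.range k, gap (m + i) ≤ 2 * gap m := by
  have h : ∑ i ∈ Finset.range k, gap (m + i) + 2 * gap (m + k) ≤ 2 * gap m := by
    induction k with
    | zero => simp
    | succ k ih =>
      rw [Finset.sum_range_succ]
      have := gap_succ_le (m + k)
      have := gap_pos (m + k)
      rw [← add_assoc]
      linarith
  linarith [gap_pos (m + k)]

lemma sum_Ico_gap_le (m n : ℕ) : ∑ i ∈ Finset.Ico m n, gap i ≤ 2 * gap m := by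
  rw [Finset.sum_Ico_eq_sum_range]
  exact sum_gap_le m _

/-- The angle whose digits are the first `n` binary digits of `a`, the `i`-th digit having
weight `gap i`. -/
def angle (n a : ℕ) : ℝ := ∑ i ∈ Finset.range n, if a.testBit i then gap i else 0

lemma abs_digit_sub_le (a b i : ℕ) :
    |(if a.testBit i then gap i else 0) - (if b.testBit i then gap i else 0)| ≤ gap i := by
  have := gap_pos i
  split_ifs <;> simp [abs_of_pos, this, this.le]

lemma testBit_eq_of_modEq {m a b i : ℕ} (h : a ≡ b [MOD 2 ^ m]) (hi : i < m) :
    a.testBit i = b.testBit i := by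
  have h' := congrArg (fun c : ℕ => c.testBit i) h
  simpa [Nat.testBit_mod_two_pow, hi] using h'

lemma abs_angle_sub_le {n m a b : ℕ} (hm : m ≤ n) (h : a ≡ b [MOD 2 ^ m]) :
    |angle n a - angle n b| ≤ 2 * gap m := by
  have h0 : angle n a - angle n b = ∑ i ∈ Finset.Ico m n,
      ((if a.testBit i then gap i else 0) - (if b.testBit i then gap i else 0)) := by
    rw [angle, angle, ← Finset.sum_sub_distrib, ← Finset.sum_range_add_sum_Ico _ hm,
      add_eq_right]
    exact Finset.sum_eq_zero fun i hi => by
      rw [testBit_eq_of_modEq h (Finset.mem_range.1 hi), sub_self]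
  rw [h0]
  exact (Finset.abs_sum_le_sum_abs _ _).trans
    ((Finset.sum_le_sum fun i _ => abs_digit_sub_le a b i).trans (sum_Ico_gap_le m n))

lemma abs_angle_sub_le_two (n a b : ℕ) : |angle n a - angle n b| ≤ 2 := by
  have := abs_angle_sub_le (a := a) (b := b) (Nat.zero_le n) (by simp [Nat.modEq_one])
  linarith [gap_lt_half 0]

lemma le_abs_angle_sub_of_testBit_ne {n m a b : ℕ} (hm : m < n) (h : a ≡ b [MOD 2 ^ m])
    (hne : a.testBit m ≠ b.testBit m) : gap m / 2 ≤ |angle n a - angle n b| := by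
  set d : ℕ → ℝ := fun i =>
    (if a.testBit i then gap i else 0) - (if b.testBit i then gap i else 0) with hd
  have h0 : angle n a - angle n b = d m + ∑ i ∈ Finset.Ico (m + 1) n, d i := by
    rw [angle, angle, ← Finset.sum_sub_distrib, ← Finset.sum_range_add_sum_Ico _ hm,
      Finset.sum_range_succ, add_assoc, add_eq_right]
    exact Finset.sum_eq_zero fun i hi => by
      rw [testBit_eq_of_modEq h (Finset.mem_range.1 hi), sub_self]
  have h1 : |∑ i ∈ Finset.Ico (m + 1) n, d i| ≤ 2 * gap (m + 1) :=
    (Finset.abs_sum_le_sum_abs _ _).trans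
      ((Finset.sum_le_sum fun i _ => abs_digit_sub_le a b i).trans (sum_Ico_gap_le _ n))
  have h2 : |d m| = gap m := by
    have := gap_pos m
    simp only [hd]
    cases ha : a.testBit m <;> cases hb : b.testBit m <;> simp_all [abs_of_pos]
  have h3 := abs_sub_abs_le_abs_sub (d m) (-∑ i ∈ Finset.Ico (m + 1) n, d i)
  rw [abs_neg, sub_neg_eq_add, ← h0, h2] at h3
  linarith [gap_succ_le m, gap_pos m]

lemma le_abs_angle_sub {n m a b : ℕ} (hm : m < n) (h : ¬ a ≡ b [MOD 2 ^ (m + 1)]) :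
    gap m / 2 ≤ |angle n a - angle n b| := by
  classical
  have hex : ∃ k, ¬ a ≡ b [MOD 2 ^ k] := ⟨_, h⟩
  have hle : Nat.find hex ≤ m + 1 := Nat.find_min' hex h
  obtain ⟨i, hi⟩ : ∃ i, Nat.find hex = i + 1 := by
    refine Nat.exists_eq_add_one_of_ne_zero fun h0 => ?_
    have := Nat.find_spec hex
    rw [h0] at this
    exact this (by simp [Nat.modEq_one])
  have h1 : ¬ a ≡ b [MOD 2 ^ (i + 1)] := hi ▸ Nat.find_spec hex
  have h2 : a ≡ b [MOD 2 ^ i] := not_not.1 (Nat.find_min hex (by omega))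
  have him : i ≤ m := by omega
  have h3 : a.testBit i ≠ b.testBit i := by
    refine fun h3 => h1 (Nat.eq_of_testBit_eq fun k => ?_)
    simp only [Nat.testBit_mod_two_pow]
    rcases lt_trichotomy k i with hk | hk | hk
    · rw [testBit_eq_of_modEq h2 hk]
    · rw [hk, h3]
    · simp [show ¬ k < i + 1 by omega]
  linarith [le_abs_angle_sub_of_testBit_ne (him.trans_lt hm) h2 h3, gap_anti him]

lemma card_modEq_two_pow {m n : ℕ} (hm : m ≤ n) (a : ℕ) :
    ((Finset.range (2 ^ n)).filter fun b => b ≡ a [MOD 2 ^ m]).card = 2 ^ (n - m) := by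
  rw [← Nat.count_eq_card_filter_range, Nat.count_modEq_card _ (by positivity),
    Nat.pow_div hm (by norm_num), (Nat.dvd_iff_mod_eq_zero).1 (pow_dvd_pow 2 hm)]
  simp

/-- The points of the `n`-th generation of the Cantor-type construction. -/
def cantorPt (n a : ℕ) : ℂ := ((1 - gap n : ℝ) : ℂ) * Complex.exp (angle n a * Complex.I)

lemma norm_cantorPt (n a : ℕ) : ‖cantorPt n a‖ = 1 - gap n := by
  rw [cantorPt, norm_mul, Complex.norm_exp_ofReal_mul_I, mul_one, Complex.norm_real,
    Real.norm_of_nonneg (by linarith [gap_lt_half n])]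

lemma cantorPt_mem_ball (n a : ℕ) : cantorPt n a ∈ Metric.ball (0 : ℂ) 1 := by
  rw [mem_ball_zero_iff, norm_cantorPt]
  linarith [gap_pos n]

lemma norm_exp_sub_exp (x y : ℝ) :
    ‖Complex.exp (x * Complex.I) - Complex.exp (y * Complex.I)‖
      = ‖Complex.exp (Complex.I * ((x - y : ℝ) : ℂ)) - 1‖ := by
  have : Complex.exp (x * Complex.I) - Complex.exp (y * Complex.I)
      = Complex.exp (y * Complex.I) * (Complex.exp (Complex.I * ((x - y : ℝ) : ℂ)) - 1) := by
    rw [mul_sub, mul_one, ← Complex.exp_add]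
    push_cast
    ring_nf
  rw [this, norm_mul, Complex.norm_exp_ofReal_mul_I, one_mul]

lemma half_abs_le_norm_exp_sub_exp {x y : ℝ} (h : |x - y| ≤ 2) :
    |x - y| / 2 ≤ ‖Complex.exp (x * Complex.I) - Complex.exp (y * Complex.I)‖ := by
  rw [norm_exp_sub_exp, Complex.norm_exp_I_mul_ofReal_sub_one, norm_mul]
  have hpi := Real.pi_gt_three
  have hpi4 := Real.pi_le_four
  have h1 : |(x - y) / 2| = |x - y| / 2 := by rw [abs_div, abs_two]
  have h2 := Real.mul_abs_le_abs_sin (x := (x - y) / 2) (by rw [h1]; linarith)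
  rw [h1] at h2
  have h3 : (1 : ℝ) / 2 ≤ 2 / Real.pi := by
    rw [div_le_div_iff₀ (by norm_num) (by linarith)]; linarith
  have h4 := mul_le_mul_of_nonneg_right h3 (show 0 ≤ |x - y| / 2 by positivity)
  rw [Real.norm_eq_abs, Real.norm_eq_abs, abs_two]
  linarith

lemma norm_exp_sub_exp_le (x y : ℝ) :
    ‖Complex.exp (x * Complex.I) - Complex.exp (y * Complex.I)‖ ≤ |x - y| := by
  rw [norm_exp_sub_exp]
  exact Real.norm_exp_I_mul_ofReal_sub_one_le

lemma le_norm_cantorPt_sub {n m a b : ℕ} (hm : m < n) (h : ¬ a ≡ b [MOD 2 ^ (m + 1)]) :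
    gap m / 8 ≤ ‖cantorPt n a - cantorPt n b‖ := by
  rw [cantorPt, cantorPt, ← mul_sub, norm_mul, Complex.norm_real,
    Real.norm_of_nonneg (by linarith [gap_lt_half n])]
  have h1 := half_abs_le_norm_exp_sub_exp (abs_angle_sub_le_two n a b)
  have h2 := le_abs_angle_sub hm h
  have h3 := gap_lt_half n
  have h4 := gap_pos m
  calc gap m / 8 = (1 / 2) * (gap m / 4) := by ring
    _ ≤ _ := by gcongr <;> linarith

lemma norm_sub_le_of_mem_carlesonBox {θ ℓ : ℝ} (hℓ1 : ℓ < 1) {z w : ℂ}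
    (hz : z ∈ carlesonBox θ ℓ) (hw : w ∈ carlesonBox θ ℓ) : ‖z - w‖ ≤ 2 * ℓ := by
  obtain ⟨r, x, hr, hr1, hx, hx1, rfl⟩ := hz
  obtain ⟨s, y, hs, hs1, hy, hy1, rfl⟩ := hw
  have h : (r : ℂ) * Complex.exp (x * Complex.I) - s * Complex.exp (y * Complex.I)
      = ((r - s : ℝ) : ℂ) * Complex.exp (x * Complex.I)
        + (s : ℂ) * (Complex.exp (x * Complex.I) - Complex.exp (y * Complex.I)) := by
    push_cast; ring
  rw [h]
  refine (norm_add_le _ _).trans ?_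
  rw [norm_mul, norm_mul, Complex.norm_exp_ofReal_mul_I, mul_one, Complex.norm_real,
    Complex.norm_real, Real.norm_eq_abs, Real.norm_of_nonneg (by linarith)]
  have h1 : |r - s| ≤ ℓ := abs_le.2 ⟨by linarith, by linarith⟩
  have h2 : |x - y| ≤ ℓ := abs_le.2 ⟨by linarith, by linarith⟩
  have h3 := norm_exp_sub_exp_le x y
  have h4 : s * ‖Complex.exp (x * Complex.I) - Complex.exp (y * Complex.I)‖ ≤ 1 * ℓ := by
    gcongr
    exact h3.trans h2
  linarith

lemma lt_norm_of_mem_carlesonBox {θ ℓ : ℝ} (hℓ1 : ℓ < 1) {z : ℂ}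
    (hz : z ∈ carlesonBox θ ℓ) : 1 - ℓ < ‖z‖ := by
  obtain ⟨r, x, hr, hr1, hx, hx1, rfl⟩ := hz
  rw [norm_mul, Complex.norm_exp_ofReal_mul_I, mul_one, Complex.norm_real,
    Real.norm_of_nonneg (by linarith)]
  exact hr

lemma inv_two_pow_le {k : ℕ} {ℓ α : ℝ} (hα1 : α ≤ 1) (h1 : ℓ < gap 0)
    (hk : gap (k + 1) < ℓ) :
    ((2 : ℝ) ^ k)⁻¹ ≤ 64 * ((Real.log (1/ℓ))⁻¹ * (Real.log (Real.log (1/ℓ))) ^ (-α)) := by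
  have hℓ : 0 < ℓ := (gap_pos _).trans hk
  set L := Real.log (1 / ℓ) with hL
  have hLe : L = -Real.log ℓ := by rw [hL, one_div, Real.log_inv]
  have h12 : 12 < L := by
    have := Real.log_lt_log hℓ h1
    rw [gap, Real.log_exp, gapLog_zero] at this
    linarith
  have hLk : L < gapLog (k + 1) := by
    have := Real.log_lt_log (gap_pos _) hk
    rw [gap, Real.log_exp] at this
    linarith
  have hM1 : 1 ≤ Real.log L := by
    rw [Real.le_log_iff_exp_le (by linarith)]
    linarith [Real.exp_one_lt_d9]
  have hM : Real.log L ≤ k + 4 := by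
    rw [Real.log_le_iff_le_exp (by linarith)]
    have h2 : gapLog (k + 1) ≤ 16 * 2 ^ k := by
      unfold gapLog
      rw [div_le_iff₀ (by positivity), pow_succ]
      push_cast
      have : (0 : ℝ) ≤ k * 2 ^ k := by positivity
      nlinarith
    have he : (2 : ℝ) ≤ Real.exp 1 := by linarith [Real.add_one_le_exp (1 : ℝ)]
    have h3 : Real.exp (k + 4) = Real.exp 1 ^ (k + 4) := by
      rw [← Real.exp_nat_mul]; push_cast; ring_nf
    rw [h3]
    calc L ≤ 16 * 2 ^ k := hLk.le.trans h2
      _ = 2 ^ (k + 4) := by ring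
      _ ≤ _ := by gcongr
  have hLp : 0 < L := by linarith
  have hMp : 0 < Real.log L := by linarith
  have hp : L * Real.log L ≤ 64 * 2 ^ k := by
    have : L * Real.log L ≤ gapLog (k + 1) * (k + 4) := by
      gcongr
      exact hLp.le.trans hLk.le
    refine this.trans ?_
    unfold gapLog
    rw [div_mul_eq_mul_div, div_le_iff₀ (by positivity), pow_succ]
    push_cast
    have : (0 : ℝ) ≤ k * 2 ^ k := by positivity
    nlinarith
  have hrp : (Real.log L)⁻¹ ≤ Real.log L ^ (-α) := by
    rw [← Real.rpow_neg_one]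
    exact Real.rpow_le_rpow_of_exponent_le hM1 (by linarith)
  calc ((2 : ℝ) ^ k)⁻¹ ≤ 64 * (L⁻¹ * (Real.log L)⁻¹) := by
        rw [← mul_inv, ← div_eq_mul_inv, inv_eq_one_div,
          div_le_div_iff₀ (by positivity) (by positivity)]
        linarith
    _ ≤ _ := by gcongr

open Classical in
lemma card_cantorPt_mem_carlesonBox_le {α θ ℓ : ℝ} (hα1 : α ≤ 1) (h1 : ℓ < gap 0)
    (n : ℕ) :
    (((Finset.range (2 ^ n)).filter fun a => cantorPt n a ∈ carlesonBox θ ℓ).card : ℝ) / 2 ^ n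
      ≤ max 0 (64 * ((Real.log (1/ℓ))⁻¹ * (Real.log (Real.log (1/ℓ))) ^ (-α))) := by
  rcases Finset.eq_empty_or_nonempty
    ((Finset.range (2 ^ n)).filter fun a => cantorPt n a ∈ carlesonBox θ ℓ) with he | ⟨a, ha⟩
  · rw [he]; simp
  have ha := (Finset.mem_filter.1 ha).2
  have hℓ1 : ℓ < 1 := by linarith [gap_lt_half 0]
  have hn : gap n < ℓ := by
    have := lt_norm_of_mem_carlesonBox hℓ1 ha
    rw [norm_cantorPt] at this
    linarith
  have hex : ∃ j, gap j < ℓ := ⟨n, hn⟩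
  have hjn := Nat.find_min' hex hn
  obtain ⟨k, hk⟩ : ∃ k, Nat.find hex = k + 1 := by
    refine Nat.exists_eq_add_one_of_ne_zero fun h0 => ?_
    have := Nat.find_spec hex
    rw [h0] at this
    linarith
  have hk1 : gap (k + 1) < ℓ := hk ▸ Nat.find_spec hex
  have hk2 : ℓ ≤ gap k := not_lt.1 (Nat.find_min hex (by omega))
  refine le_max_of_le_right ((?_ : _ ≤ ((2 : ℝ) ^ k)⁻¹).trans (inv_two_pow_le hα1 h1 hk1))
  have hsub : ((Finset.range (2 ^ n)).filter fun b => cantorPt n b ∈ carlesonBox θ ℓ) ⊆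
      (Finset.range (2 ^ n)).filter fun b => b ≡ a [MOD 2 ^ k] := by
    intro b hb
    rw [Finset.mem_filter] at hb ⊢
    refine ⟨hb.1, ?_⟩
    by_contra hne
    obtain ⟨m, rfl⟩ : ∃ m, k = m + 1 := Nat.exists_eq_add_one_of_ne_zero fun h0 => by
      subst h0; exact hne (by simp [Nat.modEq_one])
    have h3 := le_norm_cantorPt_sub (n := n) (by omega) hne
    have h4 := norm_sub_le_of_mem_carlesonBox hℓ1 hb.2 ha
    linarith [gap_succ_le m, gap_pos m]
  have hc := Finset.card_le_card hsub
  rw [card_modEq_two_pow (by omega)] at hc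
  have hpow : ((2 : ℝ) ^ k)⁻¹ * 2 ^ n = 2 ^ (n - k) := by
    rw [inv_mul_eq_iff_eq_mul₀ (by positivity), ← pow_add, Nat.add_sub_cancel' (by omega)]
  rw [div_le_iff₀ (by positivity), hpow]
  exact_mod_cast hc

/-! ### Logarithmic energy -/

/-- The discrete logarithmic energy of the points `w i`, `i ∈ s`. -/
def logEnergy (s : Finset ℕ) (w : ℕ → ℂ) : ℝ :=
  ∑ i ∈ s, ∑ j ∈ s, -Real.log ‖1 - w i * starRingEnd ℂ (w j)‖

lemma hasSum_logEnergy {s : Finset ℕ} {w : ℕ → ℂ} (hw : ∀ i ∈ s, ‖w i‖ < 1) :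
    HasSum (fun k : ℕ => ‖∑ i ∈ s, w i ^ (k + 1)‖ ^ 2 / ((k : ℝ) + 1)) (logEnergy s w) := by
  have h1 : ∀ i ∈ s, ∀ j ∈ s, HasSum
      (fun k : ℕ => ((w i * starRingEnd ℂ (w j)) ^ (k + 1) / ((k : ℂ) + 1)).re)
      (-Real.log ‖1 - w i * starRingEnd ℂ (w j)‖) := by
    intro i hi j hj
    have hlt : ‖w i * starRingEnd ℂ (w j)‖ < 1 := by
      rw [norm_mul, RCLike.norm_conj]
      exact mul_lt_one_of_nonneg_of_lt_one_left (norm_nonneg _) (hw i hi) (hw j hj).le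
    have h := (hasSum_nat_add_iff' 1).2 (Complex.hasSum_taylorSeries_neg_log hlt)
    have h' := Complex.hasSum_re h
    simpa [Complex.log_re] using h'
  have h2 := hasSum_sum fun i hi => hasSum_sum fun j hj => h1 i hi j hj
  refine h2.congr_fun fun k => ?_
  have h3 : ((‖∑ i ∈ s, w i ^ (k + 1)‖ ^ 2 / ((k : ℝ) + 1) : ℝ) : ℂ)
      = ∑ i ∈ s, ∑ j ∈ s, (w i * starRingEnd ℂ (w j)) ^ (k + 1) / ((k : ℂ) + 1) := by
    push_cast
    rw [← Complex.mul_conj', map_sum, Finset.sum_mul_sum, Finset.sum_div]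
    refine Finset.sum_congr rfl fun i _ => ?_
    rw [Finset.sum_div]
    refine Finset.sum_congr rfl fun j _ => ?_
    rw [map_pow, mul_pow]
  have h4 := congrArg Complex.re h3
  rw [Complex.ofReal_re] at h4
  rw [h4]
  simp only [Complex.re_sum]

lemma norm_one_sub_cantorPt_mul_conj_le (n a b : ℕ) :
    ‖1 - cantorPt n a * starRingEnd ℂ (cantorPt n b)‖ ≤ 2 * gap n + |angle n a - angle n b| := by
  set r : ℝ := 1 - gap n with hr
  have hr0 : 0 ≤ r := by linarith [gap_lt_half n]
  have hr1 : r ≤ 1 := by linarith [gap_pos n]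
  have h : 1 - cantorPt n a * starRingEnd ℂ (cantorPt n b)
      = ((1 - r ^ 2 : ℝ) : ℂ)
        - ((r ^ 2 : ℝ) : ℂ) *
          (Complex.exp (Complex.I * ((angle n a - angle n b : ℝ) : ℂ)) - 1) := by
    have he : Complex.exp (Complex.I * ((angle n a - angle n b : ℝ) : ℂ))
        = Complex.exp (angle n a * Complex.I) * Complex.exp (-(angle n b * Complex.I)) := by
      rw [← Complex.exp_add]; push_cast; ring_nf
    rw [he, cantorPt, cantorPt, ← hr]
    simp only [map_mul, Complex.conj_ofReal, ← Complex.exp_conj, Complex.conj_I]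
    push_cast
    ring_nf
  rw [h]
  refine (norm_sub_le _ _).trans ?_
  rw [norm_mul, Complex.norm_real, Complex.norm_real, Real.norm_of_nonneg (by nlinarith),
    Real.norm_of_nonneg (by positivity)]
  have h1 := Real.norm_exp_I_mul_ofReal_sub_one_le (x := angle n a - angle n b)
  rw [Real.norm_eq_abs] at h1
  have h2 : r ^ 2 * ‖Complex.exp (Complex.I * ((angle n a - angle n b : ℝ) : ℂ)) - 1‖
      ≤ 1 * |angle n a - angle n b| := by
    gcongr
    nlinarith
  nlinarith

lemma exists_modEq_sum_gapLog_sub_le (a b n : ℕ) :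
    ∃ j ≤ n, a ≡ b [MOD 2 ^ j] ∧
      ∑ m ∈ Finset.range n, (if b ≡ a [MOD 2 ^ (m + 1)] then gapLog (m + 1) - gapLog m else 0)
        ≤ gapLog j - gapLog 0 := by
  induction n with
  | zero => exact ⟨0, le_rfl, by simp [Nat.modEq_one], by simp⟩
  | succ n ih =>
    by_cases h : b ≡ a [MOD 2 ^ (n + 1)]
    · refine ⟨n + 1, le_rfl, h.symm, ?_⟩
      rw [← Finset.sum_range_sub gapLog]
      refine Finset.sum_le_sum fun m _ => ?_
      have := four_le_gapLog_succ_sub m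
      split_ifs <;> linarith
    · obtain ⟨j, hj, hab, hs⟩ := ih
      refine ⟨j, by omega, hab, ?_⟩
      rwa [Finset.sum_range_succ, if_neg h, add_zero]

lemma sum_gapLog_sub_le_neg_log (n a b : ℕ) :
    ∑ m ∈ Finset.range n, (if b ≡ a [MOD 2 ^ (m + 1)] then gapLog (m + 1) - gapLog m else 0)
      ≤ -Real.log ‖1 - cantorPt n a * starRingEnd ℂ (cantorPt n b)‖ := by
  obtain ⟨j, hj, hab, hs⟩ := exists_modEq_sum_gapLog_sub_le a b n
  refine hs.trans ?_
  have h1 := norm_one_sub_cantorPt_mul_conj_le n a b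
  have h2 := abs_angle_sub_le hj hab
  have h3 := gap_anti hj
  have hlt : ‖cantorPt n a * starRingEnd ℂ (cantorPt n b)‖ < 1 := by
    rw [norm_mul, RCLike.norm_conj, norm_cantorPt, norm_cantorPt]
    nlinarith [gap_pos n, gap_lt_half n]
  have hpos : 0 < ‖1 - cantorPt n a * starRingEnd ℂ (cantorPt n b)‖ := by
    rw [norm_pos_iff]
    intro h0
    rw [← sub_eq_zero.1 h0, norm_one] at hlt
    exact lt_irrefl _ hlt
  have h4 := Real.log_le_log hpos (by linarith :
    ‖1 - cantorPt n a * starRingEnd ℂ (cantorPt n b)‖ ≤ 4 * gap j)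
  rw [Real.log_mul (by norm_num) (gap_pos j).ne', gap, Real.log_exp] at h4
  have h5 := Real.log_le_sub_one_of_pos (show (0 : ℝ) < 4 by norm_num)
  linarith [gapLog_zero]

lemma le_logEnergy_cantorPt (n : ℕ) :
    4 ^ n * ∑ m ∈ Finset.range n, 1 / ((m : ℝ) + 1)
      ≤ logEnergy (Finset.range (2 ^ n)) (cantorPt n) := by
  have h1 : ∀ a, 2 ^ n * ∑ m ∈ Finset.range n, 1 / ((m : ℝ) + 1) ≤
      ∑ b ∈ Finset.range (2 ^ n),
        -Real.log ‖1 - cantorPt n a * starRingEnd ℂ (cantorPt n b)‖ := by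
    intro a
    refine le_trans ?_ (Finset.sum_le_sum fun b _ => sum_gapLog_sub_le_neg_log n a b)
    rw [Finset.sum_comm, Finset.mul_sum]
    refine Finset.sum_le_sum fun m hm => ?_
    have hm : m + 1 ≤ n := Finset.mem_range.1 hm
    rw [← Finset.sum_filter, Finset.sum_const, card_modEq_two_pow hm, nsmul_eq_mul]
    push_cast
    calc (2 : ℝ) ^ n * (1 / ((m : ℝ) + 1))
        ≤ 2 ^ n * ((gapLog (m + 1) - gapLog m) / 2 ^ (m + 1)) := by
          exact mul_le_mul_of_nonneg_left (inv_succ_le_gapLog_succ_sub m) (by positivity)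
      _ = _ := by
          rw [← Nat.sub_add_cancel hm, pow_add, Nat.add_sub_cancel]
          field_simp
  calc (4 : ℝ) ^ n * ∑ m ∈ Finset.range n, 1 / ((m : ℝ) + 1)
      = ∑ a ∈ Finset.range (2 ^ n), 2 ^ n * ∑ m ∈ Finset.range n, 1 / ((m : ℝ) + 1) := by
        rw [Finset.sum_const, Finset.card_range, nsmul_eq_mul, ← mul_assoc]
        push_cast
        rw [← mul_pow]; norm_num
    _ ≤ _ := Finset.sum_le_sum fun a _ => h1 a

/-! ### The Dirichlet integral of a polynomial -/

lemma integral_exp_int_mul_I {d : ℤ} (hd : d ≠ 0) :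
    ∫ θ in Set.Ioo (-Real.pi) Real.pi, Complex.exp (d * Complex.I * θ) = 0 := by
  rw [← integral_Ioc_eq_integral_Ioo,
    ← intervalIntegral.integral_of_le (by linarith [Real.pi_pos]),
    integral_exp_mul_complex (mul_ne_zero (by exact_mod_cast hd) Complex.I_ne_zero)]
  have h : Complex.exp (d * Complex.I * (Real.pi : ℝ))
      = Complex.exp (d * Complex.I * ((-Real.pi : ℝ) : ℂ)) := by
    rw [Complex.exp_eq_exp_iff_exists_int]
    exact ⟨d, by push_cast; ring⟩
  rw [h, sub_self, zero_div]

lemma integral_ball_pow_mul_conj_pow (j k : ℕ) :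
    ∫ z in Metric.ball (0 : ℂ) 1, z ^ j * (starRingEnd ℂ z) ^ k
      = if j = k then (Real.pi : ℂ) / (k + 1) else 0 := by
  rw [← integral_indicator measurableSet_ball, ← Complex.integral_comp_polarCoord_symm,
    polarCoord_target]
  have h1 : ∀ p ∈ Set.Ioi (0 : ℝ) ×ˢ Set.Ioo (-Real.pi) Real.pi,
      p.1 • (Metric.ball (0 : ℂ) 1).indicator (fun z => z ^ j * (starRingEnd ℂ z) ^ k)
        (Complex.polarCoord.symm p)
      = (Set.Iio (1 : ℝ)).indicator (fun r => ((r ^ (j + k + 1) : ℝ) : ℂ)) p.1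
        * Complex.exp (((j : ℤ) - (k : ℤ) : ℤ) * Complex.I * p.2) := by
    rintro ⟨r, θ⟩ ⟨hr, -⟩
    have hr : 0 < r := hr
    have hs : Complex.polarCoord.symm (r, θ) = r * Complex.exp (θ * Complex.I) := by
      rw [Complex.polarCoord_symm_apply, Complex.exp_mul_I]; push_cast; rfl
    have hm : (r * Complex.exp (θ * Complex.I) : ℂ) ∈ Metric.ball (0 : ℂ) 1
        ↔ r ∈ Set.Iio (1 : ℝ) := by
      rw [mem_ball_zero_iff, norm_mul, Complex.norm_exp_ofReal_mul_I, mul_one,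
        Complex.norm_real, Real.norm_of_nonneg hr.le, Set.mem_Iio]
    rw [hs]
    by_cases h : r ∈ Set.Iio (1 : ℝ)
    · rw [Set.indicator_of_mem (hm.2 h), Set.indicator_of_mem h]
      have he : Complex.exp (((j : ℤ) - (k : ℤ) : ℤ) * Complex.I * θ)
          = Complex.exp (θ * Complex.I) ^ j * Complex.exp (-(θ * Complex.I)) ^ k := by
        rw [← Complex.exp_nat_mul, ← Complex.exp_nat_mul, ← Complex.exp_add]
        push_cast; ring_nf
      simp only [he, map_mul, Complex.conj_ofReal, ← Complex.exp_conj, Complex.conj_I,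
        Complex.real_smul]
      push_cast
      ring_nf
    · rw [Set.indicator_of_notMem (mt hm.1 h), Set.indicator_of_notMem h]; simp
  rw [setIntegral_congr_fun (measurableSet_Ioi.prod measurableSet_Ioo) h1, Measure.volume_eq_prod,
    setIntegral_prod_mul ((Set.Iio (1 : ℝ)).indicator fun r => ((r ^ (j + k + 1) : ℝ) : ℂ))
      (fun θ : ℝ => Complex.exp (((j : ℤ) - (k : ℤ) : ℤ) * Complex.I * θ))]
  split_ifs with hjk
  · subst hjk
    rw [setIntegral_indicator measurableSet_Iio, Set.Ioi_inter_Iio,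
      ← integral_Ioc_eq_integral_Ioo, ← intervalIntegral.integral_of_le zero_le_one,
      intervalIntegral.integral_ofReal, integral_pow]
    simp only [sub_self, Int.cast_zero, zero_mul, Complex.exp_zero]
    rw [setIntegral_const]
    have h2 : (j : ℂ) + 1 ≠ 0 := by exact_mod_cast Nat.succ_ne_zero j
    have h3 : (j : ℂ) + j + 1 + 1 = 2 * (j + 1) := by ring
    simp only [one_pow, Measure.real, Real.volume_Ioo, sub_neg_eq_add,
      ENNReal.toReal_ofReal (by positivity : 0 ≤ Real.pi + Real.pi), Complex.real_smul]
    push_cast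
    rw [h3, zero_pow (by omega)]
    field_simp
    ring
  · rw [integral_exp_int_mul_I (by omega), mul_zero]

lemma integral_ball_normSq_sum (s : Finset ℕ) (c : ℕ → ℂ) :
    ∫ z in Metric.ball (0 : ℂ) 1, ‖∑ k ∈ s, c k * z ^ k‖ ^ 2
      = Real.pi * ∑ k ∈ s, ‖c k‖ ^ 2 / (k + 1) := by
  have h : ∀ z : ℂ, ((‖∑ k ∈ s, c k * z ^ k‖ ^ 2 : ℝ) : ℂ)
      = ∑ j ∈ s, ∑ k ∈ s, (c j * starRingEnd ℂ (c k)) * (z ^ j * (starRingEnd ℂ z) ^ k) := by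
    intro z
    push_cast
    rw [← Complex.mul_conj', map_sum, Finset.sum_mul_sum]
    refine Finset.sum_congr rfl fun j _ => Finset.sum_congr rfl fun k _ => ?_
    rw [map_mul, map_pow]
    ring
  have hint : ∀ j k : ℕ, IntegrableOn
      (fun z : ℂ => (c j * starRingEnd ℂ (c k)) * (z ^ j * (starRingEnd ℂ z) ^ k))
      (Metric.ball (0 : ℂ) 1) := fun j k =>
    ((by fun_prop : Continuous fun z : ℂ => (c j * starRingEnd ℂ (c k)) *
      (z ^ j * (starRingEnd ℂ z) ^ k)).continuousOn.integrableOn_compact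
      (isCompact_closedBall (0 : ℂ) 1)).mono_set ball_subset_closedBall
  apply Complex.ofReal_injective
  rw [← integral_complex_ofReal]
  simp_rw [h]
  rw [integral_finsetSum _ fun j _ => integrable_finsetSum _ fun k _ => hint j k]
  push_cast
  rw [Finset.mul_sum]
  refine Finset.sum_congr rfl fun j hj => ?_
  rw [integral_finsetSum _ fun k _ => hint j k]
  simp_rw [integral_const_mul, integral_ball_pow_mul_conj_pow]
  rw [Finset.sum_eq_single j (fun k _ hk => by simp [hk.symm]) (fun h => absurd hj h), if_pos rfl,
    Complex.mul_conj']
  ring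

/-- The polynomial `∑_{k=1}^N c_k z^k / k`. -/
def testPoly (c : ℕ → ℂ) (N : ℕ) (z : ℂ) : ℂ :=
  ∑ k ∈ Finset.range N, c (k + 1) / (k + 1) * z ^ (k + 1)

lemma deriv_testPoly (c : ℕ → ℂ) (N : ℕ) (z : ℂ) :
    deriv (testPoly c N) z = ∑ k ∈ Finset.range N, c (k + 1) * z ^ k := by
  refine HasDerivAt.deriv (HasDerivAt.fun_sum fun k _ => ?_)
  have hk : (k : ℂ) + 1 ≠ 0 := by exact_mod_cast Nat.succ_ne_zero k
  refine ((hasDerivAt_pow (k + 1) z).const_mul (c (k + 1) / (k + 1))).congr_deriv ?_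
  rw [Nat.add_sub_cancel, ← mul_assoc, Nat.cast_succ, div_mul_cancel₀ _ hk]

lemma inDirichlet_testPoly (c : ℕ → ℂ) (N : ℕ) : InDirichlet (testPoly c N) := by
  constructor
  · unfold testPoly
    fun_prop
  · simp_rw [deriv_testPoly]
    exact ((by fun_prop : Continuous fun z : ℂ => ‖∑ k ∈ Finset.range N, c (k + 1) * z ^ k‖ ^ 2
      ).continuousOn.integrableOn_compact (isCompact_closedBall (0 : ℂ) 1)).mono_set
      ball_subset_closedBall

lemma dirichletNormSq_testPoly (c : ℕ → ℂ) (N : ℕ) :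
    dirichletNormSq (testPoly c N) = ∑ k ∈ Finset.range N, ‖c (k + 1)‖ ^ 2 / (k + 1) := by
  unfold dirichletNormSq
  simp_rw [deriv_testPoly]
  rw [integral_ball_normSq_sum _ fun k => c (k + 1)]
  have h0 : testPoly c N 0 = 0 := by simp [testPoly]
  rw [h0, norm_zero, ← mul_assoc, one_div_mul_cancel Real.pi_ne_zero]
  simp

/-! ### Energy bound for Carleson measures -/

lemma IsCarlesonDirichlet.exists_mul_logEnergy_le {μ : Measure ℂ} (hμ : IsCarlesonDirichlet μ) :
    ∃ C : ℝ, ∀ (s : Finset ℕ) (w : ℕ → ℂ) (t : ℝ), 0 < t → (∀ i ∈ s, w i ∈ ball (0 : ℂ) 1) →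
      ∑ i ∈ s, ENNReal.ofReal t • Measure.dirac (w i) ≤ μ →
      t * logEnergy s w ≤ C * s.card := by
  obtain ⟨C₀, hC₀⟩ := hμ
  obtain ⟨C, hC, hCC⟩ : ∃ C : ℝ, 0 ≤ C ∧ C₀ ≤ C := ⟨max 0 C₀, le_max_left _ _, le_max_right _ _⟩
  refine ⟨C, fun s w t ht hw hle => ?_⟩
  have hw' : ∀ i ∈ s, ‖w i‖ < 1 := fun i hi => mem_ball_zero_iff.1 (hw i hi)
  refine le_of_tendsto ((hasSum_logEnergy hw').tendsto_sum_nat.const_mul t)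
    (Eventually.of_forall fun N => ?_)
  set P : ℕ → ℂ := fun k => ∑ i ∈ s, w i ^ k with hP
  set E : ℝ := ∑ k ∈ Finset.range N, ‖P (k + 1)‖ ^ 2 / ((k : ℝ) + 1) with hE
  change t * E ≤ C * s.card
  set f := testPoly (fun k => starRingEnd ℂ (P k)) N with hf
  have hE0 : 0 ≤ E := Finset.sum_nonneg fun k _ => by positivity
  have hnorm : dirichletNormSq f = E := by
    rw [hf, dirichletNormSq_testPoly]
    simp [hE]
  have hsum : ∑ i ∈ s, f (w i) = (E : ℂ) := by
    simp only [hf, testPoly, hE]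
    rw [Finset.sum_comm]
    push_cast
    refine Finset.sum_congr rfl fun k _ => ?_
    rw [← Finset.mul_sum, ← Complex.mul_conj']
    simp only [hP]
    ring
  have hcs : E ^ 2 ≤ s.card * ∑ i ∈ s, ‖f (w i)‖ ^ 2 := by
    refine le_trans ?_ sq_sum_le_card_mul_sum_sq
    gcongr
    have := norm_sum_le s fun i => f (w i)
    rwa [hsum, Complex.norm_real, Real.norm_of_nonneg hE0] at this
  have hcar : t * ∑ i ∈ s, ‖f (w i)‖ ^ 2 ≤ C * E := by
    have h1 := hC₀ f (inDirichlet_testPoly _ N)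
    rw [hnorm] at h1
    have h2 : ENNReal.ofReal (t * ∑ i ∈ s, ‖f (w i)‖ ^ 2)
        = ∫⁻ z in Metric.ball (0:ℂ) 1, ENNReal.ofReal (‖f z‖ ^ 2)
          ∂(∑ i ∈ s, ENNReal.ofReal t • Measure.dirac (w i)) := by
      rw [← lintegral_indicator measurableSet_ball, lintegral_finsetSum_measure, Finset.mul_sum,
        ENNReal.ofReal_sum_of_nonneg fun i _ => by positivity]
      refine Finset.sum_congr rfl fun i hi => ?_
      rw [lintegral_smul_measure, lintegral_dirac, Set.indicator_of_mem (hw i hi), smul_eq_mul,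
        ENNReal.ofReal_mul ht.le]
    have h3 := (h2.le.trans (lintegral_mono' (Measure.restrict_mono le_rfl hle) le_rfl)).trans
      (h1.trans (ENNReal.ofReal_le_ofReal (mul_le_mul_of_nonneg_right hCC hE0)))
    exact (ENNReal.ofReal_le_ofReal_iff (by positivity)).1 h3
  rcases hE0.eq_or_lt with h0 | h0
  · rw [← h0, mul_zero]; positivity
  · have h4 : t * E * E ≤ C * s.card * E := by
      calc t * E * E = t * E ^ 2 := by ring
        _ ≤ t * (s.card * ∑ i ∈ s, ‖f (w i)‖ ^ 2) := by gcongr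
        _ = s.card * (t * ∑ i ∈ s, ‖f (w i)‖ ^ 2) := by ring
        _ ≤ s.card * (C * E) := by gcongr
        _ = _ := by ring
    exact le_of_mul_le_mul_right h4 h0

/-! ### The measure -/

/-- The measure of mass `t` distributed uniformly on the `n`-th generation of the
Cantor-type construction. -/
def cantorMeasure (t : ℝ) (n : ℕ) : Measure ℂ :=
  ∑ a ∈ Finset.range (2 ^ n), ENNReal.ofReal (t / 2 ^ n) • Measure.dirac (cantorPt n a)

open Classical in
lemma cantorMeasure_apply {t : ℝ} (ht : 0 ≤ t) (n : ℕ) (s : Set ℂ) :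
    cantorMeasure t n s = ENNReal.ofReal
      (t * ((((Finset.range (2 ^ n)).filter fun a => cantorPt n a ∈ s).card : ℝ) / 2 ^ n)) := by
  have h : ∀ a, (ENNReal.ofReal (t / 2 ^ n) • Measure.dirac (cantorPt n a)) s
      = ENNReal.ofReal (if cantorPt n a ∈ s then t / 2 ^ n else 0) := by
    intro a
    rw [Measure.smul_apply, Measure.dirac_apply, smul_eq_mul]
    by_cases h : cantorPt n a ∈ s <;> simp [h]
  rw [cantorMeasure, Measure.finsetSum_apply]
  simp_rw [h]
  rw [← ENNReal.ofReal_sum_of_nonneg fun a _ => by split_ifs <;> positivity,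
    ← Finset.sum_filter, Finset.sum_const, nsmul_eq_mul]
  congr 1
  ring

/-- The superposition of the measures `cantorMeasure (2 ^ -(j + 1)) (N j)`. -/
def cantorSum (N : ℕ → ℕ) : Measure ℂ :=
  Measure.sum fun j => cantorMeasure ((1 / 2) ^ (j + 1)) (N j)

open Classical in
lemma cantorSum_apply_le (N : ℕ → ℕ) (s : Set ℂ) {B : ℝ} (hB : 0 ≤ B)
    (h : ∀ n, (((Finset.range (2 ^ n)).filter fun a => cantorPt n a ∈ s).card : ℝ) / 2 ^ n ≤ B) :
    cantorSum N s ≤ ENNReal.ofReal B := by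
  obtain ⟨t, hst, ht, hμ⟩ := exists_measurable_superset_forall_eq
    (fun j => cantorMeasure ((1 / 2) ^ (j + 1)) (N j)) s
  have hgeo : HasSum (fun j : ℕ => (1 / 2 : ℝ) ^ (j + 1) * B) B := by
    have h1 := (hasSum_geometric_two.mul_left (1 / 2 : ℝ)).mul_right B
    have h2 : (1 / 2 : ℝ) * 2 * B = B := by ring
    rw [h2] at h1
    refine h1.congr_fun fun j => ?_
    rw [pow_succ']
  calc cantorSum N s ≤ cantorSum N t := measure_mono hst
    _ = ∑' j, cantorMeasure ((1 / 2) ^ (j + 1)) (N j) s := by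
        rw [cantorSum, Measure.sum_apply _ ht]
        simp_rw [hμ]
    _ ≤ ∑' j, ENNReal.ofReal ((1 / 2) ^ (j + 1) * B) := by
        refine ENNReal.tsum_le_tsum fun j => ?_
        rw [cantorMeasure_apply (by positivity)]
        gcongr
        exact h _
    _ = ENNReal.ofReal B := by
        rw [← ENNReal.ofReal_tsum_of_nonneg (fun j => by positivity) hgeo.summable, hgeo.tsum_eq]

lemma not_isCarlesonDirichlet_cantorSum {N : ℕ → ℕ}
    (hN : ∀ j, (4 : ℝ) ^ j ≤ ∑ m ∈ Finset.range (N j), 1 / ((m : ℝ) + 1)) :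
    ¬ IsCarlesonDirichlet (cantorSum N) := by
  intro hμ
  obtain ⟨C, hC⟩ := hμ.exists_mul_logEnergy_le
  have h1 : ∀ j : ℕ, (2 : ℝ) ^ j ≤ 2 * C := by
    intro j
    have h2 := hC (Finset.range (2 ^ N j)) (cantorPt (N j)) ((1 / 2) ^ (j + 1) / 2 ^ N j)
      (by positivity) (fun a _ => cantorPt_mem_ball _ a)
      (Measure.le_sum (fun j => cantorMeasure ((1 / 2) ^ (j + 1)) (N j)) j)
    have h3 : (1 / 2 : ℝ) ^ (j + 1) / 2 ^ N j * (4 ^ N j * 4 ^ j)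
        ≤ C * (Finset.range (2 ^ N j)).card := by
      refine le_trans ?_ h2
      gcongr
      refine le_trans ?_ (le_logEnergy_cantorPt (N j))
      gcongr
      exact hN j
    rw [Finset.card_range] at h3
    push_cast at h3
    have h4 : (1 / 2 : ℝ) ^ (j + 1) / 2 ^ N j * (4 ^ N j * 4 ^ j) = 2 ^ j / 2 * 2 ^ N j := by
      rw [show (4 : ℝ) = 2 * 2 by norm_num, mul_pow, mul_pow, one_div, inv_pow, pow_succ]
      field_simp
    rw [h4] at h3
    have := le_of_mul_le_mul_right h3 (by positivity)
    linarith
  obtain ⟨j, hj⟩ := pow_unbounded_of_one_lt (2 * C) (one_lt_two (α := ℝ))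
  exact absurd (h1 j) (not_le.2 hj)

/-- For every `0 < α ≤ 1` there is a finite Borel measure `μ` on the unit disk with
`μ(S(I)) = O((log(1/|I|))⁻¹ (log log(1/|I|))^{-α})` as `|I| → 0` which is not a
Carleson measure for the Dirichlet space. -/
theorem statement3 (α : ℝ) (hα0 : 0 < α) (hα1 : α ≤ 1) :
    ∃ μ : Measure ℂ, IsFiniteMeasure μ ∧ μ (Metric.ball (0:ℂ) 1)ᶜ = 0 ∧
      (∃ C > (0:ℝ), ∃ ε > (0:ℝ), ∀ θ ℓ : ℝ, 0 < ℓ → ℓ < ε →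
        μ (carlesonBox θ ℓ) ≤ ENNReal.ofReal
          (C * ((Real.log (1/ℓ))⁻¹ * (Real.log (Real.log (1/ℓ))) ^ (-α)))) ∧
      ¬ IsCarlesonDirichlet μ := by
  have hex : ∀ j : ℕ, ∃ n : ℕ, (4 : ℝ) ^ j ≤ ∑ m ∈ Finset.range n, 1 / ((m : ℝ) + 1) := fun j =>
    (Real.tendsto_sum_range_one_div_nat_succ_atTop.eventually_ge_atTop _).exists
  choose N hN using hex
  refine ⟨cantorSum N, ⟨?_⟩, ?_, ⟨64, by norm_num, gap 0, gap_pos 0, fun θ ℓ hℓ hℓ1 => ?_⟩,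
    not_isCarlesonDirichlet_cantorSum hN⟩
  · refine (cantorSum_apply_le N univ zero_le_one fun n => ?_).trans_lt ENNReal.ofReal_lt_top
    simp
  · refine le_antisymm ((cantorSum_apply_le N _ le_rfl fun n => ?_).trans_eq
      ENNReal.ofReal_zero) zero_le
    simp [cantorPt_mem_ball, -mem_ball]
  · refine (cantorSum_apply_le N _ (le_max_left 0 _) fun n =>
      card_cantorPt_mem_carlesonBox_le hα1 hℓ1 n).trans_eq ?_
    rw [ENNReal.ofReal_max, ENNReal.ofReal_zero]
    exact max_eq_right zero_le

end
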